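/- Let p(T) ∈ 𝔽_q[T] be irreducible with p(T) ≠ T and deg p(T) = d, and let α be the image of T in κ_{p(T)}, so that α^{q^d} = α. Then in the rational function field κ_{p(T)}(s) the following identity holds: u_d^{(p(T))}( −α^q · s(s+1)^{q−1} ) = (α(s+1))^{q^d − 1} · u_d^{(p(T))}( −α · s^q/(s+1)^{q−1} ), where u_d^{(p(T))} is evaluated at the indicated rational functions. -/

import Mathlib

open Polynomial

/-- The universal supersingular polynomials `u_i(s) ∈ 𝔽_q[T][s]` of Bassa–Beelen, with the
index shifted by one: `uPoly F q 0 = u_{-1} = 0`, `uPoly F q 1 = u_0 = 1`, and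
`u_{i+1}(s) = (s + T^q)^{q^i} u_i(s) - (T^{q^i} - T) s^{q^i} u_{i-1}(s)`.
Here the inner `Polynomial.X : Polynomial F` plays the role of `T` and the outer
variable plays the role of `s`. -/
noncomputable def uPoly (F : Type*) [Field F] (q : ℕ) : ℕ → Polynomial (Polynomial F)
  | 0 => 0
  | 1 => 1
  | i + 2 =>
      (X + C ((X : Polynomial F) ^ q)) ^ (q ^ i) * uPoly F q (i + 1)
        - C ((X : Polynomial F) ^ (q ^ i) - X) * X ^ (q ^ i) * uPoly F q i

theorem add_pow_card_pow (F : Type*) {R : Type*} [Field F] [Fintype F] [CommRing R] [Algebra F R]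
    (x y : R) (n : ℕ) :
    (x + y) ^ Fintype.card F ^ n = x ^ Fintype.card F ^ n + y ^ Fintype.card F ^ n := by
  have h := map_add ((FiniteField.frobeniusAlgHom F R) ^ n) x y
  simpa only [AlgHom.coe_pow, FiniteField.coe_frobeniusAlgHom, pow_iterate] using h

theorem neg_pow_card (F : Type*) {R : Type*} [Field F] [Fintype F] [CommRing R] [Algebra F R]
    (x : R) : (-x) ^ Fintype.card F = -x ^ Fintype.card F := by
  simpa only [FiniteField.coe_frobeniusAlgHom] using map_neg (FiniteField.frobeniusAlgHom F R) x

theorem eval₂_uPoly_add_two {F R : Type*} [Field F] [CommRing R] (ψ : F[X] →+* R) (x : R)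
    (q n : ℕ) :
    (uPoly F q (n + 2)).eval₂ ψ x =
      (x + ψ X ^ q) ^ q ^ n * (uPoly F q (n + 1)).eval₂ ψ x -
        (ψ X ^ q ^ n - ψ X) * x ^ q ^ n * (uPoly F q n).eval₂ ψ x := by
  rw [uPoly]
  simp only [eval₂_sub, eval₂_mul, eval₂_pow, eval₂_add, eval₂_X, eval₂_C, map_sub, map_pow]

/-- Effect on `uPoly` of the isogeny `(1 + τ) a` between the rank two Drinfeld modules
`T ↦ T + (x + T ^ q) τ + x ^ q τ ^ 2` and `T ↦ T + (y + T ^ q) τ + y ^ q τ ^ 2`. -/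
theorem mul_eval₂_uPoly_of_isogeny {F R : Type*} [Field F] [Fintype F] [CommRing R]
    (ψ : F[X] →+* R) {q : ℕ} (hF : Fintype.card F = q) {a x y : R}
    (h₁ : a * (x + ψ X ^ q) = a ^ q * (ψ X + y)) (h₂ : a * x ^ q = a ^ q ^ 2 * y) (n : ℕ) :
    a * (uPoly F q (n + 1)).eval₂ ψ x =
      a ^ q ^ n * ((uPoly F q (n + 1)).eval₂ ψ y +
        (ψ X - ψ X ^ q ^ n) * (uPoly F q n).eval₂ ψ y) := by
  let _ : Algebra F R := (ψ.comp C).toAlgebra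
  have add_pow (u v : R) (k : ℕ) : (u + v) ^ q ^ k = u ^ q ^ k + v ^ q ^ k := by
    subst hF
    exact add_pow_card_pow F u v k
  induction n using Nat.strong_induction_on with
  | _ n ih =>
    match n with
    | 0 => simp [uPoly]
    | 1 =>
      simp only [eval₂_uPoly_add_two]
      simp only [uPoly, eval₂_one, eval₂_zero, pow_zero, pow_one]
      linear_combination h₁
    | n + 2 =>
      have e₁ := ih (n + 1) (by omega)
      have e₀ := ih n (by omega)
      have k₁ := congrArg (· ^ q ^ (n + 1)) h₁
      have k₂ := congrArg (· ^ q ^ n) h₂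
      have rx := eval₂_uPoly_add_two ψ x q (n + 1)
      have ry := eval₂_uPoly_add_two ψ y q (n + 1)
      have ry' := eval₂_uPoly_add_two ψ y q n
      have p₁ : q * q ^ n = q ^ (n + 1) := (pow_succ' q n).symm
      have p₂ : q * q ^ (n + 1) = q ^ (n + 2) := (pow_succ' q (n + 1)).symm
      have p₃ : q ^ 2 * q ^ n = q ^ (n + 2) := by ring
      simp only [mul_pow, add_pow, ← pow_mul, p₁, p₂, p₃, add_assoc, Nat.reduceAdd]
        at k₁ k₂ rx ry ry' e₁ e₀ ⊢
      rw [rx, ry]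
      generalize (uPoly F q (n + 2)).eval₂ ψ x = U₂ at *
      generalize (uPoly F q (n + 1)).eval₂ ψ x = U₁ at *
      generalize (uPoly F q (n + 2)).eval₂ ψ y = V₂ at *
      generalize (uPoly F q (n + 1)).eval₂ ψ y = V₁ at *
      generalize (uPoly F q n).eval₂ ψ y = V₀ at *
      generalize ψ X = T at *
      linear_combination (x ^ q ^ (n + 1) + T ^ q ^ (n + 2)) * e₁
        + (T - T ^ q ^ (n + 1)) * x ^ q ^ (n + 1) * e₀
        + (V₂ + (T - T ^ q ^ (n + 1)) * V₁) * k₁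
        + (T - T ^ q ^ (n + 1)) * (V₁ + (T - T ^ q ^ n) * V₀) * k₂
        - (T - T ^ q ^ (n + 1)) * a ^ q ^ (n + 2) * ry'

theorem eval₂_zero_uPoly_eq_zero {F R : Type*} [Field F] [CommRing R] (ψ : F[X] →+* R)
    (hψ : ψ X = 0) {q : ℕ} (hq : q ≠ 0) (n : ℕ) : (uPoly F q (n + 2)).eval₂ ψ 0 = 0 := by
  rw [eval₂_uPoly_add_two]
  simp [hψ, hq]

theorem AdjoinRoot.root_pow_card_pow_natDegree {F : Type*} [Field F] [Fintype F] (p : F[X])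
    [hp : Fact (Irreducible p)] :
    AdjoinRoot.root p ^ Fintype.card F ^ p.natDegree = AdjoinRoot.root p := by
  have hp₀ := hp.out.ne_zero
  let b := AdjoinRoot.powerBasis hp₀
  have : Module.Finite F (AdjoinRoot p) := b.finite
  have : Finite (AdjoinRoot p) := Module.finite_of_finite F
  have := Fintype.ofFinite (AdjoinRoot p)
  have h := FiniteField.pow_card (AdjoinRoot.root p)
  rwa [Module.card_eq_pow_finrank (K := F), b.finrank, AdjoinRoot.powerBasis_dim] at h

/-- For `p(T)` irreducible of degree `d` with `p(T) ≠ T`, and `α` the image of `T` in the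
residue field `κ_{p(T)} = 𝔽_q[T]/(p(T))` (realized as `AdjoinRoot p`), in the rational
function field `κ_{p(T)}(s)` one has
`u_d^{(p(T))}(-α^q s(s+1)^{q-1}) = (α(s+1))^{q^d - 1} u_d^{(p(T))}(-α s^q/(s+1)^{q-1})`. -/
theorem uPoly_reduction_identity (q : ℕ) (F : Type*) [Field F] [Fintype F]
    (hF : Fintype.card F = q) (p : Polynomial F) [hp : Fact (Irreducible p)] (hpX : p ≠ X) :
    let d := p.natDegree
    let α : RatFunc (AdjoinRoot p) := RatFunc.C (AdjoinRoot.root p)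
    let s : RatFunc (AdjoinRoot p) := RatFunc.X
    let ψ : Polynomial F →+* RatFunc (AdjoinRoot p) :=
      (RatFunc.C : AdjoinRoot p →+* RatFunc (AdjoinRoot p)).comp (AdjoinRoot.mk p)
    Polynomial.eval₂ ψ (-α ^ q * (s * (s + 1) ^ (q - 1))) (uPoly F q (d + 1))
      = (α * (s + 1)) ^ (q ^ d - 1) *
          Polynomial.eval₂ ψ (-α * (s ^ q / (s + 1) ^ (q - 1))) (uPoly F q (d + 1)) := by
  intro d α s ψ
  have hψ : ψ X = α := by simp [ψ, α]
  have hq : 1 < q := hF ▸ Fintype.one_lt_card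
  have hd : 0 < d := hp.out.natDegree_pos
  have hqd : 1 < q ^ d := Nat.one_lt_pow hd.ne' hq
  by_cases hα : α = 0
  · obtain ⟨e, he⟩ := Nat.exists_eq_add_of_lt hd
    have hu := eval₂_zero_uPoly_eq_zero ψ (hψ.trans hα) (by omega : q ≠ 0) e
    have hde : d + 1 = e + 2 := by omega
    simp [hα, hde, hu, show q ≠ 0 by omega]
  have hs : s + 1 ≠ 0 := by
    have h : (X + C 1 : (AdjoinRoot p)[X]) ≠ 0 := X_add_C_ne_zero 1
    have h' := (map_ne_zero_iff (algebraMap (AdjoinRoot p)[X] (RatFunc (AdjoinRoot p)))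
      (RatFunc.algebraMap_injective _)).2 h
    simpa [s] using h'
  have hαd : α ^ q ^ d = α := by
    rw [← hF, ← map_pow, AdjoinRoot.root_pow_card_pow_natDegree]
  let _ : Algebra F (RatFunc (AdjoinRoot p)) := (ψ.comp C).toAlgebra
  have hsq : (s + 1) ^ q = s ^ q + 1 := by
    simpa [hF] using add_pow_card_pow F s 1 1
  have hneg (u : RatFunc (AdjoinRoot p)) : (-u) ^ q = -u ^ q := by
    simpa only [hF] using neg_pow_card F u
  obtain ⟨m, rfl⟩ : ∃ m, q = m + 1 := ⟨q - 1, by omega⟩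
  have hQ : s ^ (m + 1) / (s + 1) ^ m * (s + 1) ^ m = s ^ (m + 1) :=
    div_mul_cancel₀ _ (pow_ne_zero m hs)
  have hw : (s + 1) ^ (m + 1) ^ 2 = ((s + 1) ^ m) ^ (m + 1) * (s + 1) ^ m * (s + 1) := by
    rw [← pow_mul, ← pow_add, ← pow_succ]
    congr 1
    ring
  have hmain := mul_eval₂_uPoly_of_isogeny ψ hF (a := α * (s + 1))
    (x := -α ^ (m + 1) * (s * (s + 1) ^ m)) (y := -α * (s ^ (m + 1) / (s + 1) ^ m))
    (by
      rw [hψ, mul_pow]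
      linear_combination α ^ (m + 2) * (s + 1) * (hQ - hsq))
    (by
      rw [neg_mul, hneg, mul_pow α, hw]
      linear_combination -α ^ ((m + 1) ^ 2 + 1) * (s + 1) * ((s + 1) ^ m) ^ (m + 1) * hQ.symm) d
  rw [hψ, hαd, sub_self, zero_mul, add_zero] at hmain
  have ha : α * (s + 1) ≠ 0 := mul_ne_zero hα hs
  apply mul_left_cancel₀ ha
  rw [Nat.add_sub_cancel, hmain, ← mul_assoc, ← pow_succ', Nat.sub_add_cancel hqd.le]
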